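/- Consider the full one-sided shift on two symbols, σ : {0,1}^ℕ → {0,1}^ℕ, (σx)(n) = x(n+1). For k ≥ 1, let N(k) denote the (finite) number of points x with least period exactly k, and let Γ(k) denote the number of even orbits of least period exactly k. Then for every k ≥ 1: N(k) = k · ( 2·Γ(k) + Σ_{m ≥ 1, 2^m divides k} Γ(k / 2^m) ). Equivalently, writing L(k) = Σ Γ(j) over all j < k such that k/j is a power of 2, the number of even orbits of least period k satisfies Γ(k) = (N(k)/k − L(k))/2. -/

import Mathlib

/-- The full one-sided shift on two symbols. -/
def twoShift : (ℕ → Bool) → (ℕ → Bool) := fun x n => x (n + 1)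

/-- `x` has least period exactly `k` under the shift. -/
def ShiftLeastPeriod (k : ℕ) (x : ℕ → Bool) : Prop :=
  twoShift^[k] x = x ∧ ∀ j : ℕ, 0 < j → j < k → twoShift^[j] x ≠ x

/-- The (period-`k`) orbit `{x, σx, …, σ^{k−1}x}` of `x` under the shift. -/
def shiftOrbit (k : ℕ) (x : ℕ → Bool) : Set (ℕ → Bool) :=
  {y | ∃ i : ℕ, i < k ∧ y = twoShift^[i] x}

/-- `x` is even over one period of length `k`: the number of indices `i < k`
with `x i = 1` (i.e. `true`) is even. -/
def EvenSymbolSeq (k : ℕ) (x : ℕ → Bool) : Prop :=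
  Even ((Finset.range k).filter (fun i => x i = true)).card

/-- `N(k)`: the number of points of least period exactly `k`. -/
noncomputable def leastPeriodPointCount (k : ℕ) : ℕ :=
  Set.ncard {x : ℕ → Bool | ShiftLeastPeriod k x}

/-- `Γ(k)`: the number of even orbits of least period exactly `k`. -/
noncomputable def evenOrbitCount (k : ℕ) : ℕ :=
  Set.ncard {O : Set (ℕ → Bool) |
    ∃ x : ℕ → Bool, ShiftLeastPeriod k x ∧ EvenSymbolSeq k x ∧ O = shiftOrbit k x}

open Function

theorem twoShift_iterate_apply (p : ℕ) (x : ℕ → Bool) (n : ℕ) :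
    (twoShift^[p] x) n = x (n + p) := by
  induction p generalizing x with
  | zero => rfl
  | succ p ih => rw [iterate_succ_apply, ih]; simp only [twoShift]; congr 1

/-- The sum modulo two of consecutive symbols. -/
def symbolDiff (x : ℕ → Bool) : ℕ → Bool := fun n => xor (x n) (x (n + 1))

/-- The sequence with initial symbol `b` whose consecutive sums modulo two are `y`. -/
def symbolSum (b : Bool) (y : ℕ → Bool) : ℕ → Bool
  | 0 => b
  | n + 1 => xor (symbolSum b y n) (y n)

theorem symbolDiff_symbolSum (b : Bool) (y : ℕ → Bool) : symbolDiff (symbolSum b y) = y := by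
  funext n
  simp [symbolDiff, symbolSum]

theorem symbolSum_symbolDiff (x : ℕ → Bool) : symbolSum (x 0) (symbolDiff x) = x := by
  funext n
  induction n with
  | zero => rfl
  | succ n ih => simp [symbolSum, ih, symbolDiff]

/-- A sequence is determined by its initial symbol and its consecutive sums modulo two. -/
def symbolDiffEquiv : (ℕ → Bool) ≃ Bool × (ℕ → Bool) where
  toFun x := (x 0, symbolDiff x)
  invFun p := symbolSum p.1 p.2
  left_inv := symbolSum_symbolDiff
  right_inv p := Prod.ext rfl (symbolDiff_symbolSum p.1 p.2)

theorem ncard_preimage_symbolDiff (A : Set (ℕ → Bool)) :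
    (symbolDiff ⁻¹' A).ncard = 2 * A.ncard := by
  have h : symbolDiff ⁻¹' A = symbolDiffEquiv ⁻¹' (Set.univ ×ˢ A) := by
    ext x
    simp [symbolDiffEquiv]
  rw [h, Set.ncard_preimage_of_injective_subset_range symbolDiffEquiv.injective (by simp),
    Set.ncard_prod, Set.ncard_univ]
  simp

theorem symbolDiff_iterate (p : ℕ) (x : ℕ → Bool) :
    symbolDiff (twoShift^[p] x) = twoShift^[p] (symbolDiff x) := by
  funext n
  simp only [symbolDiff, twoShift_iterate_apply]
  congr 2
  omega

theorem evenSymbolSeq_symbolDiff (p : ℕ) (x : ℕ → Bool) :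
    EvenSymbolSeq p (symbolDiff x) ↔ x p = x 0 := by
  unfold EvenSymbolSeq
  induction p with
  | zero => simp
  | succ p ih =>
    rw [Finset.range_add_one, Finset.filter_insert]
    split_ifs with h
    · rw [Finset.card_insert_of_notMem (by simp), Nat.even_add_one, ih]
      revert h
      simp only [symbolDiff]
      cases x p <;> cases x (p + 1) <;> cases x 0 <;> simp
    · rw [ih]
      revert h
      simp only [symbolDiff]
      cases x p <;> cases x (p + 1) <;> cases x 0 <;> simp

theorem isPeriodicPt_iff_symbolDiff (p : ℕ) (x : ℕ → Bool) :
    IsPeriodicPt twoShift p x ↔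
      IsPeriodicPt twoShift p (symbolDiff x) ∧ EvenSymbolSeq p (symbolDiff x) := by
  have h0 : (twoShift^[p] x) 0 = x p := by rw [twoShift_iterate_apply, zero_add]
  rw [evenSymbolSeq_symbolDiff, ← h0]
  simp only [IsPeriodicPt, IsFixedPt, ← symbolDiff_iterate]
  refine ⟨fun h => by simp [h], fun h => ?_⟩
  exact symbolDiffEquiv.injective (Prod.ext h.2 h.1)

theorem evenSymbolSeq_two_mul {j : ℕ} {y : ℕ → Bool} (h : IsPeriodicPt twoShift j y) :
    EvenSymbolSeq (2 * j) y := by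
  obtain ⟨x, rfl⟩ : ∃ x, symbolDiff x = y := ⟨_, symbolDiff_symbolSum false y⟩
  rw [evenSymbolSeq_symbolDiff]
  have h2 : EvenSymbolSeq j (twoShift^[j] (symbolDiff x)) ↔ EvenSymbolSeq j (symbolDiff x) := by
    rw [h.eq]
  rw [← symbolDiff_iterate, evenSymbolSeq_symbolDiff, evenSymbolSeq_symbolDiff,
    twoShift_iterate_apply, twoShift_iterate_apply, zero_add, ← two_mul] at h2
  revert h2
  cases x (2 * j) <;> cases x j <;> cases x 0 <;> simp

theorem evenSymbolSeq_twoShift {k : ℕ} {y : ℕ → Bool} (h : IsPeriodicPt twoShift k y) :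
    EvenSymbolSeq k (twoShift y) ↔ EvenSymbolSeq k y := by
  obtain ⟨x, rfl⟩ : ∃ x, symbolDiff x = y := ⟨_, symbolDiff_symbolSum false y⟩
  have h1 := symbolDiff_iterate 1 x
  simp only [iterate_one] at h1
  rw [← h1, evenSymbolSeq_symbolDiff, evenSymbolSeq_symbolDiff]
  have h2 := congrFun h.eq 0
  simp only [twoShift_iterate_apply, symbolDiff, zero_add] at h2
  simp only [twoShift, zero_add]
  revert h2
  cases x k <;> cases x (k + 1) <;> cases x 0 <;> cases x 1 <;> simp

theorem evenSymbolSeq_iterate {k : ℕ} {y : ℕ → Bool} (h : IsPeriodicPt twoShift k y) (i : ℕ) :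
    EvenSymbolSeq k (twoShift^[i] y) ↔ EvenSymbolSeq k y := by
  induction i with
  | zero => rfl
  | succ i ih => rw [iterate_succ_apply', evenSymbolSeq_twoShift (h.apply_iterate i), ih]

open Classical in
theorem minimalPeriod_eq_symbolDiff (x : ℕ → Bool) :
    minimalPeriod twoShift x =
      if EvenSymbolSeq (minimalPeriod twoShift (symbolDiff x)) (symbolDiff x)
      then minimalPeriod twoShift (symbolDiff x)
      else 2 * minimalPeriod twoShift (symbolDiff x) := by
  have hper := isPeriodicPt_minimalPeriod twoShift (symbolDiff x)
  have hdvd : minimalPeriod twoShift (symbolDiff x) ∣ minimalPeriod twoShift x :=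
    ((isPeriodicPt_iff_symbolDiff _ x).1 (isPeriodicPt_minimalPeriod twoShift x)).1
      |>.minimalPeriod_dvd
  split_ifs with h
  · exact Nat.dvd_antisymm ((isPeriodicPt_iff_symbolDiff _ x).2 ⟨hper, h⟩).minimalPeriod_dvd hdvd
  · have h2 : minimalPeriod twoShift x ∣ 2 * minimalPeriod twoShift (symbolDiff x) :=
      ((isPeriodicPt_iff_symbolDiff _ x).2
        ⟨hper.const_mul 2, evenSymbolSeq_two_mul hper⟩).minimalPeriod_dvd
    have hne : minimalPeriod twoShift x ≠ minimalPeriod twoShift (symbolDiff x) := fun he =>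
      h ((isPeriodicPt_iff_symbolDiff _ x).1 (he ▸ isPeriodicPt_minimalPeriod twoShift x)).2
    obtain ⟨c, hc⟩ := hdvd
    rw [hc] at h2 hne ⊢
    rcases Nat.eq_zero_or_pos (minimalPeriod twoShift (symbolDiff x)) with h0 | h0
    · simp [h0]
    · rw [mul_comm 2] at h2 ⊢
      have hc2 := (Nat.prime_two.eq_one_or_self_of_dvd c (Nat.dvd_of_mul_dvd_mul_left h0 h2))
      rcases hc2 with rfl | rfl
      · simp at hne
      · rfl

theorem shiftLeastPeriod_iff {k : ℕ} (hk : 1 ≤ k) (x : ℕ → Bool) :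
    ShiftLeastPeriod k x ↔ minimalPeriod twoShift x = k := by
  constructor
  · rintro ⟨h, hmin⟩
    have hp : IsPeriodicPt twoShift k x := h
    refine le_antisymm (hp.minimalPeriod_le hk) (not_lt.1 fun hlt => ?_)
    exact hmin _ (hp.minimalPeriod_pos hk) hlt (isPeriodicPt_minimalPeriod twoShift x)
  · rintro rfl
    refine ⟨isPeriodicPt_minimalPeriod twoShift x, fun j hj hlt h => ?_⟩
    exact not_isPeriodicPt_of_pos_of_lt_minimalPeriod hj.ne' hlt h

theorem finite_isPeriodicPt_twoShift {k : ℕ} (hk : 1 ≤ k) :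
    {x | IsPeriodicPt twoShift k x}.Finite := by
  refine Set.Finite.of_finite_image (f := fun x (i : Fin k) => x i) (Set.toFinite _) ?_
  intro x hx y hy hxy
  funext n
  have h : ∀ z : ℕ → Bool, IsPeriodicPt twoShift k z → z n = z (n % k) := fun z hz => by
    have h1 := congrFun (hz.const_mul (n / k)).eq (n % k)
    rwa [twoShift_iterate_apply, mul_comm, Nat.mod_add_div] at h1
  rw [h x hx, h y hy]
  exact congrFun hxy ⟨n % k, Nat.mod_lt _ hk⟩

theorem finite_minimalPeriod_twoShift {k : ℕ} (hk : 1 ≤ k) :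
    {x | minimalPeriod twoShift x = k}.Finite :=
  (finite_isPeriodicPt_twoShift hk).subset fun x hx => by
    subst hx; exact isPeriodicPt_minimalPeriod twoShift x

theorem leastPeriodPointCount_eq {k : ℕ} (hk : 1 ≤ k) :
    leastPeriodPointCount k = {x | minimalPeriod twoShift x = k}.ncard := by
  simp only [leastPeriodPointCount, shiftLeastPeriod_iff hk]

/-- The points of least period `k` that are even over one period. -/
def evenPoints (k : ℕ) : Set (ℕ → Bool) :=
  {x | minimalPeriod twoShift x = k ∧ EvenSymbolSeq k x}

/-- The points of least period `k` that are odd over one period. -/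
def oddPoints (k : ℕ) : Set (ℕ → Bool) :=
  {x | minimalPeriod twoShift x = k ∧ ¬ EvenSymbolSeq k x}

theorem leastPeriodPointCount_eq_even_add_odd {k : ℕ} (hk : 1 ≤ k) :
    leastPeriodPointCount k = (evenPoints k).ncard + (oddPoints k).ncard := by
  have hfin := finite_minimalPeriod_twoShift hk
  rw [leastPeriodPointCount_eq hk, ← Set.ncard_union_eq
    (Set.disjoint_left.2 fun x hx hx' => hx'.2 hx.2)
    (hfin.subset fun x hx => hx.1) (hfin.subset fun x hx => hx.1)]
  congr 1
  ext x
  simp only [evenPoints, oddPoints, Set.mem_union, Set.mem_ofPred_eq]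
  tauto

theorem leastPeriodPointCount_of_odd {k : ℕ} (hk : Odd k) :
    leastPeriodPointCount k = 2 * (evenPoints k).ncard := by
  rw [leastPeriodPointCount_eq hk.pos, ← ncard_preimage_symbolDiff]
  congr 1
  ext x
  simp only [evenPoints, Set.mem_preimage, Set.mem_ofPred_eq, minimalPeriod_eq_symbolDiff x]
  split_ifs with h
  · exact ⟨fun he => ⟨he, he ▸ h⟩, fun he => he.1⟩
  · refine ⟨fun he => ?_, fun he => absurd (he.1 ▸ he.2) h⟩
    exact absurd (he ▸ even_two_mul _) (Nat.not_even_iff_odd.2 hk)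

theorem leastPeriodPointCount_two_mul {j : ℕ} (hj : 1 ≤ j) :
    leastPeriodPointCount (2 * j) =
      2 * (evenPoints (2 * j)).ncard + 2 * (oddPoints j).ncard := by
  have h2j : 1 ≤ 2 * j := by omega
  have hset : {x | minimalPeriod twoShift x = 2 * j} =
      symbolDiff ⁻¹' (evenPoints (2 * j) ∪ oddPoints j) := by
    ext x
    simp only [evenPoints, oddPoints, Set.mem_preimage, Set.mem_union, Set.mem_ofPred_eq,
      minimalPeriod_eq_symbolDiff x]
    split_ifs with h
    · refine ⟨fun he => Or.inl ⟨he, he ▸ h⟩, ?_⟩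
      rintro (he | he)
      · exact he.1
      · exact absurd (he.1 ▸ h) he.2
    · constructor
      · intro he
        have he' : minimalPeriod twoShift (symbolDiff x) = j := by omega
        exact Or.inr ⟨he', he' ▸ h⟩
      · rintro (he | he)
        · exact absurd (he.1 ▸ he.2) h
        · rw [he.1]
  rw [leastPeriodPointCount_eq h2j, hset, ncard_preimage_symbolDiff, Set.ncard_union_eq
    (Set.disjoint_left.2 fun x hx hx' => by have h1 := hx.1; have h2 := hx'.1; omega)
    ((finite_minimalPeriod_twoShift h2j).subset fun x hx => hx.1)
    ((finite_minimalPeriod_twoShift hj).subset fun x hx => hx.1), mul_add]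

theorem ncard_shiftOrbit {k : ℕ} {x : ℕ → Bool} (hx : minimalPeriod twoShift x = k) :
    (shiftOrbit k x).ncard = k := by
  have h : shiftOrbit k x = (fun i => twoShift^[i] x) '' Set.Iio k := by
    ext y
    simp [shiftOrbit, eq_comm]
  rw [h, Set.InjOn.ncard_image (hx ▸ iterate_injOn_Iio_minimalPeriod)]
  simp [← Finset.coe_Iio, Set.ncard_coe_finset]

theorem mem_shiftOrbit_self {k : ℕ} (hk : 1 ≤ k) (x : ℕ → Bool) : x ∈ shiftOrbit k x :=
  ⟨0, hk, rfl⟩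

theorem mem_shiftOrbit_iff {k : ℕ} (hk : 1 ≤ k) {x y : ℕ → Bool}
    (hx : IsPeriodicPt twoShift k x) : y ∈ shiftOrbit k x ↔ ∃ i, y = twoShift^[i] x := by
  refine ⟨fun ⟨i, _, h⟩ => ⟨i, h⟩, fun ⟨i, h⟩ => ⟨i % k, Nat.mod_lt _ hk, ?_⟩⟩
  rw [h, hx.iterate_mod_apply]

theorem shiftOrbit_iterate {k : ℕ} (hk : 1 ≤ k) {x : ℕ → Bool}
    (hx : IsPeriodicPt twoShift k x) (i : ℕ) : shiftOrbit k (twoShift^[i] x) = shiftOrbit k x := by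
  ext y
  rw [mem_shiftOrbit_iff hk hx, mem_shiftOrbit_iff hk (hx.apply_iterate i)]
  constructor
  · rintro ⟨l, rfl⟩
    exact ⟨l + i, (iterate_add_apply _ _ _ _).symm⟩
  · rintro ⟨l, rfl⟩
    refine ⟨l + (k - 1) * i, ?_⟩
    have hi : (k - 1) * i + i = i * k := by
      obtain ⟨c, rfl⟩ := Nat.exists_eq_add_of_le' hk
      simp
      ring
    rw [← iterate_add_apply, add_assoc, hi, iterate_add_apply, (hx.const_mul i).eq]

theorem ncard_evenPoints {k : ℕ} (hk : 1 ≤ k) :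
    (evenPoints k).ncard = k * evenOrbitCount k := by
  classical
  have hfin : (evenPoints k).Finite :=
    (finite_minimalPeriod_twoShift hk).subset fun x hx => hx.1
  have horb : evenOrbitCount k = (hfin.toFinset.image (shiftOrbit k)).card := by
    rw [← Set.ncard_coe_finset, evenOrbitCount]
    congr 1
    ext O
    simp only [shiftLeastPeriod_iff hk, evenPoints, Finset.coe_image, Set.Finite.coe_toFinset,
      Set.mem_image, Set.mem_ofPred_eq, and_assoc, eq_comm (a := O)]
  rw [horb, Set.ncard_eq_toFinset_card _ hfin, mul_comm, ← smul_eq_mul]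
  rw [Finset.card_eq_sum_card_image (shiftOrbit k) hfin.toFinset]
  refine Finset.sum_const_nat fun O hO => ?_
  obtain ⟨x, hx, rfl⟩ := Finset.mem_image.1 hO
  rw [Set.Finite.mem_toFinset] at hx
  have hper : IsPeriodicPt twoShift k x := hx.1 ▸ isPeriodicPt_minimalPeriod twoShift x
  rw [← Set.ncard_coe_finset]
  refine Eq.trans ?_ (ncard_shiftOrbit hx.1)
  congr 1
  ext y
  simp only [Finset.coe_filter, Set.Finite.mem_toFinset, Set.mem_ofPred_eq]
  constructor
  · rintro ⟨-, h⟩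
    exact h ▸ mem_shiftOrbit_self hk y
  · rintro ⟨i, -, rfl⟩
    refine ⟨⟨?_, (evenSymbolSeq_iterate hper i).2 hx.2⟩, shiftOrbit_iterate hk hper i⟩
    rw [minimalPeriod_apply_iterate ⟨k, hk, hper⟩, hx.1]

theorem sum_two_pow_dvd_two_mul (g : ℕ → ℕ) {j : ℕ} (hj : 1 ≤ j) :
    (∑ m ∈ Finset.Icc 1 (2 * j), if 2 ^ m ∣ 2 * j then g (2 * j / 2 ^ m) else 0) =
      g j + ∑ m ∈ Finset.Icc 1 j, if 2 ^ m ∣ j then g (j / 2 ^ m) else 0 := by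
  have hshift : ∀ m, (if 2 ^ (m + 1) ∣ 2 * j then g (2 * j / 2 ^ (m + 1)) else 0) =
      if 2 ^ m ∣ j then g (j / 2 ^ m) else 0 := fun m => by
    simp only [pow_succ', Nat.mul_dvd_mul_iff_left two_pos, Nat.mul_div_mul_left _ _ two_pos]
  rw [← Finset.Ico_add_one_right_eq_Icc, Finset.sum_Ico_eq_sum_range]
  simp only [add_tsub_cancel_right, add_comm 1, hshift]
  rw [← Finset.Ico_add_one_right_eq_Icc, ← Finset.sum_subset (s₁ := Finset.range (j + 1))]
  · rw [Finset.range_eq_Ico, Finset.sum_eq_sum_Ico_succ_bot (by omega)]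
    simp
  · intro m hm
    rw [Finset.mem_range] at hm ⊢
    omega
  · intro m _ hm
    rw [Finset.mem_range] at hm
    refine if_neg fun h => ?_
    have h1 := Nat.le_of_dvd hj h
    have h2 : m < 2 ^ m := Nat.lt_two_pow_self
    omega

theorem leastPeriodPointCount_eq_mul (k : ℕ) (hk : 1 ≤ k) :
    leastPeriodPointCount k =
      k * (2 * evenOrbitCount k +
        ∑ m ∈ Finset.Icc 1 k, if 2 ^ m ∣ k then evenOrbitCount (k / 2 ^ m) else 0) := by
  induction k using Nat.strong_induction_on with
  | _ k ih =>
    rcases Nat.even_or_odd' k with ⟨j, rfl | rfl⟩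
    · have hj : 1 ≤ j := by omega
      have h1 := ih j (by omega) hj
      rw [leastPeriodPointCount_eq_even_add_odd hj, ncard_evenPoints hj] at h1
      rw [leastPeriodPointCount_two_mul hj, ncard_evenPoints hk, sum_two_pow_dvd_two_mul _ hj]
      linarith
    · rw [leastPeriodPointCount_of_odd ⟨j, rfl⟩, ncard_evenPoints hk, Finset.sum_eq_zero]
      · ring
      · intro m hm
        refine if_neg fun h => ?_
        have h2 := (dvd_pow_self 2 (by have := (Finset.mem_Icc.1 hm).1; omega)).trans h
        omega

/-- For every `k ≥ 1`,
`N(k) = k·(2Γ(k) + Σ_{m ≥ 1, 2^m ∣ k} Γ(k/2^m))`; equivalently, with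
`L(k) = Σ_{m ≥ 1, 2^m ∣ k} Γ(k/2^m)` (the sum of `Γ(j)` over `j < k` with `k/j`
a power of two), `Γ(k) = (N(k)/k − L(k))/2`. -/
theorem even_orbit_count_formula (k : ℕ) (hk : 1 ≤ k) :
    leastPeriodPointCount k =
      k * (2 * evenOrbitCount k +
        ∑ m ∈ Finset.Icc 1 k, if 2 ^ m ∣ k then evenOrbitCount (k / 2 ^ m) else 0) ∧
    evenOrbitCount k =
      (leastPeriodPointCount k / k -
        ∑ m ∈ Finset.Icc 1 k, if 2 ^ m ∣ k then evenOrbitCount (k / 2 ^ m) else 0) / 2 := by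
  have h := leastPeriodPointCount_eq_mul k hk
  refine ⟨h, ?_⟩
  rw [h, Nat.mul_div_cancel_left _ hk, Nat.add_sub_cancel, Nat.mul_div_cancel_left _ two_pos]
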